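/- Let T be a set of mvd clauses over a finite variable set V, and let V1, V2, V3 be pairwise disjoint subsets of V with V2 and V3 nonempty (V1 ∪ V2 ∪ V3 need not equal V). Suppose T entails the 2-quasi-Horn-style implication V1 → V2 ∨ V3, meaning that no interpretation I satisfying T has V1 ⊆ true(I) together with some v ∈ V2 and some w ∈ V3 with v, w false. Then for every variable v ∈ V \ (V1 ∪ V2 ∪ V3), either T entails V1 → (V2 ∪ {v}) ∨ V3 or T entails V1 → V2 ∨ (V3 ∪ {v}). -/

import Mathlib

open Finset

/-- An interpretation `I` (its set of true variables) violates the mvd clause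
`X → Y ∨ Z` (with `Y`, `Z` nonempty): `X ⊆ true(I)` and some `v ∈ Y`, `w ∈ Z`
are false in `I`. -/
def MvdViolates {α : Type*} [Fintype α] [DecidableEq α]
    (I X Y Z : Finset α) : Prop :=
  X ⊆ I ∧ ∃ v ∈ Y, ∃ w ∈ Z, v ∉ I ∧ w ∉ I

/-- If two interpretations both falsify `v` and satisfy an mvd clause, their intersection
satisfies it too: the side of the clause not containing `v` is true in both. -/
lemma not_mvdViolates_inter {α : Type*} [Fintype α] [DecidableEq α]
    {I J X Y Z : Finset α} {v : α} (hcover : X ∪ Y ∪ Z = Finset.univ)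
    (hvI : v ∉ I) (hvJ : v ∉ J)
    (hI : ¬ MvdViolates I X Y Z) (hJ : ¬ MvdViolates J X Y Z) :
    ¬ MvdViolates (I ∩ J) X Y Z := by
  rintro ⟨hX, y, hy, z, hz, hyIJ, hzIJ⟩
  have hXI : X ⊆ I := hX.trans inter_subset_left
  have hXJ : X ⊆ J := hX.trans inter_subset_right
  have hv : v ∈ X ∪ Y ∪ Z := hcover ▸ mem_univ v
  simp only [mem_union] at hv
  rcases hv with (hv | hv) | hv
  · exact hvI (hXI hv)
  · exact hzIJ (mem_inter.2
      ⟨by_contra fun h => hI ⟨hXI, v, hv, z, hz, hvI, h⟩,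
        by_contra fun h => hJ ⟨hXJ, v, hv, z, hz, hvJ, h⟩⟩)
  · exact hyIJ (mem_inter.2
      ⟨by_contra fun h => hI ⟨hXI, y, hy, v, hv, h, hvI⟩,
        by_contra fun h => hJ ⟨hXJ, y, hy, v, hv, h, hvJ⟩⟩)

theorem stmt_6 {α : Type*} [Fintype α] [DecidableEq α]
    (T : Set (Finset α × Finset α × Finset α))
    (hvalid : ∀ c ∈ T, Disjoint c.1 c.2.1 ∧ Disjoint c.1 c.2.2 ∧
      Disjoint c.2.1 c.2.2 ∧ c.1 ∪ c.2.1 ∪ c.2.2 = Finset.univ ∧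
      c.2.1.Nonempty ∧ c.2.2.Nonempty)
    (V1 V2 V3 : Finset α)
    (h12 : Disjoint V1 V2) (h13 : Disjoint V1 V3) (h23 : Disjoint V2 V3)
    (h2 : V2.Nonempty) (h3 : V3.Nonempty)
    (hent : ∀ I : Finset α,
      (∀ c ∈ T, ¬ MvdViolates I c.1 c.2.1 c.2.2) → ¬ MvdViolates I V1 V2 V3)
    (v : α) (hv : v ∉ V1 ∪ V2 ∪ V3) :
    (∀ I : Finset α,
        (∀ c ∈ T, ¬ MvdViolates I c.1 c.2.1 c.2.2) →
          ¬ MvdViolates I V1 (V2 ∪ {v}) V3) ∨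
    (∀ I : Finset α,
        (∀ c ∈ T, ¬ MvdViolates I c.1 c.2.1 c.2.2) →
          ¬ MvdViolates I V1 V2 (V3 ∪ {v})) := by
  by_contra hcon
  simp only [not_or, not_forall, not_not] at hcon
  obtain ⟨⟨I, hI, hV1I, a, ha, b, hb, haI, hbI⟩, ⟨J, hJ, hV1J, c, hc, d, hd, hcJ, hdJ⟩⟩ := hcon
  have hvI : v ∉ I := by
    rcases mem_union.1 ha with ha | ha
    · exact absurd ⟨hV1I, a, ha, b, hb, haI, hbI⟩ (hent I hI)
    · exact mem_singleton.1 ha ▸ haI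
  have hvJ : v ∉ J := by
    rcases mem_union.1 hd with hd | hd
    · exact absurd ⟨hV1J, c, hc, d, hd, hcJ, hdJ⟩ (hent J hJ)
    · exact mem_singleton.1 hd ▸ hdJ
  refine hent (I ∩ J) (fun e he => ?_) ⟨subset_inter hV1I hV1J, c, hc, b, hb,
    fun h => hcJ (mem_inter.1 h).2, fun h => hbI (mem_inter.1 h).1⟩
  exact not_mvdViolates_inter (hvalid e he).2.2.2.1 hvI hvJ (hI e he) (hJ e he)
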